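/- In a Coxeter system (W, S) with Bruhat order, if two elements x and y satisfy coat(x) = coat(y) and this common set of coatoms has cardinality at least 3, then x = y. -/

import Mathlib

open CoxeterSystem Polynomial

section CoxPre

variable {B : Type*} {W : Type*} [Group W] {M : CoxeterMatrix B}

/-- The alternating word of length `n` starting with the letter `i`
(and then alternating between `i` and `j`). -/
def altW (i j : B) : ℕ → List B
  | 0 => []
  | n + 1 => i :: altW j i n

variable (cs : CoxeterSystem M W)

/-- The Bruhat order on a Coxeter group: the reflexive-transitive closure of the
relation `u → u * t` (`t` a reflection) when the length goes up. -/
def bruhatLE : W → W → Prop :=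
  Relation.ReflTransGen
    (fun u v => ∃ t, cs.IsReflection t ∧ v = u * t ∧ cs.length u < cs.length v)

/-- The covering relation of the Bruhat order. -/
def bCov (u v : W) : Prop :=
  bruhatLE cs u v ∧ u ≠ v ∧ ∀ z, bruhatLE cs u z → bruhatLE cs z v → z = u ∨ z = v

/-- The set of coatoms of `v` in the Bruhat order. -/
def bCoat (v : W) : Set W := {x | bCov cs x v}

/-- A partial special matching of `W` equipped with the Bruhat order: a Bruhat order
ideal `dom` together with an involution of it such that `u ⋖ φ u` or `φ u ⋖ u` for all
`u ∈ dom`, satisfying the coatom condition. -/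
structure BSM where
  dom : Set W
  toFun : W → W
  ideal : ∀ ⦃x y : W⦄, y ∈ dom → bruhatLE cs x y → x ∈ dom
  maps : ∀ x ∈ dom, toFun x ∈ dom
  invol : ∀ x ∈ dom, toFun (toFun x) = x
  cov : ∀ x ∈ dom, bCov cs (toFun x) x ∨ bCov cs x (toFun x)
  coatom : ∀ u ∈ dom, bCov cs u (toFun u) →
    bCoat cs (toFun u) =
      {u} ∪ {w | ∃ v, bCov cs v u ∧ bCov cs v (toFun v) ∧ w = toFun v}

/-- The standard dihedral subgroup `⟨s,t⟩` of `W`, as a set. -/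
def dihedral (s t : B) : Set W :=
  (Subgroup.closure {cs.simple s, cs.simple t} : Subgroup W)

/-- `w` is full with respect to `J ⊆ S`: for all distinct `i, j ∈ J`, `m i j < ∞` and the
longest element of `⟨i,j⟩` is `≤ w` in Bruhat order. -/
def IsFullWrt (J : Set B) (w : W) : Prop :=
  ∀ i ∈ J, ∀ j ∈ J, i ≠ j →
    M i j ≠ 0 ∧ bruhatLE cs (cs.wordProd (altW i j (M i j))) w

/-- The standard axioms characterizing the `R`-polynomials of the Hecke algebra of `W`. -/
def RAxioms (R : W → W → Polynomial ℤ) : Prop :=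
  (∀ u, R u u = 1) ∧
  (∀ u v, ¬ bruhatLE cs u v → R u v = 0) ∧
  (∀ (i : B) (x y : W),
      cs.length (cs.simple i * x) = cs.length x + 1 →
      cs.length (cs.simple i * y) = cs.length y + 1 →
      R (cs.simple i * x) (cs.simple i * y) = R x y ∧
      R x (cs.simple i * y) = (X - 1) * R x y + X * R (cs.simple i * x) y) ∧
  (∀ (i : B) (x y : W),
      cs.length (x * cs.simple i) = cs.length x + 1 →
      cs.length (y * cs.simple i) = cs.length y + 1 →
      R (x * cs.simple i) (y * cs.simple i) = R x y ∧
      R x (y * cs.simple i) = (X - 1) * R x y + X * R (x * cs.simple i) y)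

variable {cs}

/-- `ψ` extends the partial special matching `φ`. -/
def BExtends (ψ φ : BSM cs) : Prop :=
  φ.dom ⊆ ψ.dom ∧ ∀ x ∈ φ.dom, ψ.toFun x = φ.toFun x

/-- `φ` is a maximal partial special matching. -/
def BMax (φ : BSM cs) : Prop := ∀ ψ : BSM cs, BExtends ψ φ → ψ.dom = φ.dom

/-- `φ` is `g`-regular on the left: its domain is stable under left multiplication by `g`
and `φ` commutes with left multiplication by `g`. -/
def LeftReg (φ : BSM cs) (g : W) : Prop :=
  (∀ x ∈ φ.dom, g * x ∈ φ.dom) ∧ ∀ x ∈ φ.dom, φ.toFun (g * x) = g * φ.toFun x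

/-- `φ` is `g`-regular on the right. -/
def RightReg (φ : BSM cs) (g : W) : Prop :=
  (∀ x ∈ φ.dom, x * g ∈ φ.dom) ∧ ∀ x ∈ φ.dom, φ.toFun (x * g) = φ.toFun x * g

end CoxPre

namespace CoxeterSystem

variable {B : Type*} {W : Type*} [Group W] {M : CoxeterMatrix B} (cs : CoxeterSystem M W)

open scoped Classical in
/-- The permutation `(t, ε) ↦ (s t s, ε + [t = s])` of `W × ZMod 2` attached to the simple
reflection `s`. -/
noncomputable def simplePerm (i : B) : Equiv.Perm (W × ZMod 2) :=
  Function.Involutive.toPerm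
    (fun p => (cs.simple i * p.1 * cs.simple i, p.2 + if p.1 = cs.simple i then 1 else 0)) <| by
      rintro ⟨t, ε⟩
      by_cases ht : t = cs.simple i
      · simp [ht, add_assoc, CharTwo.add_self_eq_zero]
      · have h : cs.simple i * t * cs.simple i ≠ cs.simple i := fun h =>
          ht <| by simpa [mul_assoc] using congrArg (cs.simple i * · * cs.simple i) h
        simp only [h, ht, if_false, add_zero]
        simp [mul_assoc]

open scoped Classical in
theorem simplePerm_apply (i : B) (p : W × ZMod 2) : cs.simplePerm i p =
    (cs.simple i * p.1 * cs.simple i, p.2 + if p.1 = cs.simple i then 1 else 0) := rfl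

open scoped Classical in
theorem prod_map_simplePerm_apply (ω : List B) (t : W) (ε : ZMod 2) :
    (ω.map cs.simplePerm).prod (t, ε) =
      (cs.wordProd ω * t * (cs.wordProd ω)⁻¹, ε + ((cs.rightInvSeq ω).count t : ℕ)) := by
  induction ω with
  | nil => simp
  | cons i ω ih =>
    have h : cs.wordProd ω * t * (cs.wordProd ω)⁻¹ = cs.simple i ↔
        (cs.wordProd ω)⁻¹ * cs.simple i * cs.wordProd ω = t := by
      constructor <;> rintro h
      · rw [← h]; group
      · rw [← h]; group
    simp only [List.map_cons, List.prod_cons, Equiv.Perm.mul_apply, ih, simplePerm_apply,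
      wordProd_cons, rightInvSeq, List.count_cons, mul_inv_rev, inv_simple, beq_iff_eq, h,
      Nat.cast_add, Nat.cast_ite, Nat.cast_one, Nat.cast_zero, add_assoc]
    simp only [mul_assoc]

theorem prod_map_alternatingWord {G : Type*} [Monoid G] (f : B → G) (i j : B) (m : ℕ) :
    ((alternatingWord i j (2 * m)).map f).prod = (f i * f j) ^ m := by
  induction m with
  | zero => simp [alternatingWord]
  | succ m ih =>
    rw [mul_add, mul_one, alternatingWord_succ, alternatingWord_succ]
    simp [ih, pow_succ]

theorem reverse_alternatingWord_two_mul (i j : B) (m : ℕ) :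
    (alternatingWord i j (2 * m)).reverse = alternatingWord j i (2 * m) := by
  apply List.ext_getElem
  · simp
  · intro k h₁ h₂
    simp only [length_alternatingWord] at h₂
    rw [List.getElem_reverse]
    simp only [length_alternatingWord]
    rw [getElem_alternatingWord _ _ _ _ (by omega), getElem_alternatingWord _ _ _ _ h₂]
    grind

open scoped Classical in
theorem even_count_rightInvSeq_alternatingWord (i j : B) (t : W) :
    Even ((cs.rightInvSeq (alternatingWord i j (2 * M i j))).count t) := by
  set m := M i j
  set g : ℕ → W := fun k => cs.wordProd (alternatingWord i j (2 * k + 1)) with hg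
  have hper : ∀ k, g (m + k) = g k := by
    intro k
    have h₁ : (2 * (m + k) + 1) / 2 = m + k := by omega
    have h₂ : (2 * k + 1) / 2 = k := by omega
    simp only [hg, prod_alternatingWord_eq_mul_pow, h₁, h₂, pow_add]
    simp [m]
  have hlis : cs.leftInvSeq (alternatingWord j i (2 * m)) = (List.range (m + m)).map g := by
    apply List.ext_getElem
    · simp [two_mul]
    · intro k h₁ h₂
      rw [getElem_leftInvSeq_alternatingWord _ _ _ _ _ (by simpa using h₁)]
      simp [hg]
  rw [← reverse_alternatingWord_two_mul, rightInvSeq_reverse, List.count_reverse, hlis,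
    List.range_add, List.map_append, List.count_append, List.map_map]
  simp [Function.comp_def, hper]

theorem isLiftable_simplePerm : M.IsLiftable cs.simplePerm := by
  classical
  intro i j
  have hone : cs.wordProd (alternatingWord i j (2 * M i j)) = 1 := by
    simp [prod_alternatingWord_eq_mul_pow]
  rw [← prod_map_alternatingWord]
  ext1 ⟨t, ε⟩
  rw [prod_map_simplePerm_apply, hone]
  simp [(ZMod.natCast_eq_zero_iff_even).2 (cs.even_count_rightInvSeq_alternatingWord i j t)]

/-- The action of `W` by permutations on `W × ZMod 2`. -/
noncomputable def reflectionPerm : W →* Equiv.Perm (W × ZMod 2) :=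
  cs.lift ⟨cs.simplePerm, cs.isLiftable_simplePerm⟩

/-- The parity of the number of occurrences of `t` in the right inversion sequence of any word
for `w`. -/
noncomputable def inversionParity (w t : W) : ZMod 2 := (cs.reflectionPerm w (t, 0)).2

open scoped Classical in
theorem reflectionPerm_wordProd (ω : List B) (t : W) (ε : ZMod 2) :
    cs.reflectionPerm (cs.wordProd ω) (t, ε) =
      (cs.wordProd ω * t * (cs.wordProd ω)⁻¹, ε + ((cs.rightInvSeq ω).count t : ℕ)) := by
  rw [← prod_map_simplePerm_apply, wordProd, map_list_prod, List.map_map]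
  congr 3
  funext i
  exact cs.lift_apply_simple cs.isLiftable_simplePerm i

open scoped Classical in
theorem inversionParity_wordProd (ω : List B) (t : W) :
    cs.inversionParity (cs.wordProd ω) t = ((cs.rightInvSeq ω).count t : ℕ) := by
  simp [inversionParity, reflectionPerm_wordProd]

theorem reflectionPerm_apply (w t : W) (ε : ZMod 2) :
    cs.reflectionPerm w (t, ε) = (w * t * w⁻¹, ε + cs.inversionParity w t) := by
  classical
  obtain ⟨ω, rfl⟩ := cs.wordProd_surjective w
  rw [reflectionPerm_wordProd, inversionParity_wordProd]

theorem inversionParity_mul (u v t : W) : cs.inversionParity (u * v) t =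
    cs.inversionParity u (v * t * v⁻¹) + cs.inversionParity v t := by
  rw [inversionParity, map_mul, Equiv.Perm.mul_apply, reflectionPerm_apply, reflectionPerm_apply]
  simp [add_comm]

@[simp]
theorem inversionParity_one (t : W) : cs.inversionParity 1 t = 0 := by
  simp [inversionParity]

open scoped Classical in
theorem inversionParity_simple (i : B) (t : W) :
    cs.inversionParity (cs.simple i) t = if t = cs.simple i then 1 else 0 := by
  have h := cs.inversionParity_wordProd [i] t
  simp only [wordProd_singleton, rightInvSeq_singleton, List.count_singleton, beq_iff_eq] at h
  rw [h]
  simp [eq_comm]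

theorem IsReflection.inversionParity_self {cs : CoxeterSystem M W} {t : W}
    (ht : cs.IsReflection t) : cs.inversionParity t t = 1 := by
  obtain ⟨u, i, rfl⟩ := ht
  have h := cs.inversionParity_mul u u⁻¹ (u * cs.simple i * u⁻¹)
  have h₁ : u⁻¹ * (u * cs.simple i * u⁻¹) * u⁻¹⁻¹ = cs.simple i := by group
  rw [mul_inv_cancel, inversionParity_one, h₁] at h
  rw [inversionParity_mul, h₁, inversionParity_mul, inversionParity_simple, if_pos rfl]
  simp only [mul_inv_cancel_right]
  rw [add_right_comm, ← h, zero_add]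

theorem mem_rightInvSeq_of_inversionParity_ne_zero {ω : List B} {t : W}
    (h : cs.inversionParity (cs.wordProd ω) t ≠ 0) : t ∈ cs.rightInvSeq ω := by
  classical
  by_contra hn
  rw [inversionParity_wordProd, List.count_eq_zero_of_not_mem hn] at h
  exact h Nat.cast_zero

theorem isRightInversion_of_inversionParity_ne_zero {w t : W}
    (h : cs.inversionParity w t ≠ 0) : cs.IsRightInversion w t := by
  obtain ⟨ω, hω, rfl⟩ := cs.exists_isReduced w
  exact cs.isRightInversion_of_mem_rightInvSeq hω (cs.mem_rightInvSeq_of_inversionParity_ne_zero h)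

theorem IsReflection.inversionParity_ne_zero_iff {cs : CoxeterSystem M W} {w t : W}
    (ht : cs.IsReflection t) :
    cs.inversionParity w t ≠ 0 ↔ cs.length (w * t) < cs.length w := by
  refine ⟨fun h => (cs.isRightInversion_of_inversionParity_ne_zero h).2, fun h h₀ => ?_⟩
  have h₁ : cs.inversionParity (w * t) t ≠ 0 := by
    rw [inversionParity_mul, mul_inv_cancel_right, h₀, ht.inversionParity_self]
    decide
  have h₂ := (cs.isRightInversion_of_inversionParity_ne_zero h₁).2
  rw [mul_assoc, ht.mul_self, mul_one] at h₂
  omega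

/-- The strong exchange property. -/
theorem exists_eraseIdx_of_isRightInversion {ω : List B} {t : W}
    (h : cs.IsRightInversion (cs.wordProd ω) t) :
    ∃ j < ω.length, cs.wordProd ω * t = cs.wordProd (ω.eraseIdx j) := by
  obtain ⟨j, hj, rfl⟩ := List.mem_iff_getElem.1 <|
    cs.mem_rightInvSeq_of_inversionParity_ne_zero (h.1.inversionParity_ne_zero_iff.2 h.2)
  refine ⟨j, by simpa using hj, ?_⟩
  rw [← wordProd_mul_getD_rightInvSeq, List.getD_eq_getElem]

theorem IsReflection.length_mul_simple_conj_lt_iff {cs : CoxeterSystem M W} {w t : W} {i : B}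
    (ht : cs.IsReflection t) (hti : t ≠ cs.simple i) :
    cs.length (w * t * cs.simple i) < cs.length (w * cs.simple i) ↔
      cs.length (w * t) < cs.length w := by
  have ht' := ht.conj (cs.simple i)
  have h := ht'.inversionParity_ne_zero_iff (w := w * cs.simple i)
  have h₁ : w * cs.simple i * (cs.simple i * t * (cs.simple i)⁻¹) = w * t * cs.simple i := by
    simp [mul_assoc]
  rw [h₁, inversionParity_mul, inversionParity_simple, if_neg, add_zero] at h
  · rw [← h, ← ht.inversionParity_ne_zero_iff]
    simp [mul_assoc]
  · intro h₂
    apply hti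
    simpa [mul_assoc] using congrArg (cs.simple i * · * cs.simple i) h₂

end CoxeterSystem

section BruhatCovers

variable {B : Type*} {W : Type*} [Group W] {M : CoxeterMatrix B} (cs : CoxeterSystem M W)

/-- One step up in the Bruhat graph. -/
def bruhatStep (u v : W) : Prop :=
  ∃ t, cs.IsReflection t ∧ v = u * t ∧ cs.length u < cs.length v

/-- One step up in the Bruhat graph that raises the length by exactly one. -/
def lengthCov (u v : W) : Prop :=
  ∃ t, cs.IsReflection t ∧ v = u * t ∧ cs.length v = cs.length u + 1

variable {cs}

theorem bruhatStep.le {u v : W} (h : bruhatStep cs u v) : bruhatLE cs u v :=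
  Relation.ReflTransGen.single h

theorem lengthCov.bruhatStep {u v : W} (h : lengthCov cs u v) : bruhatStep cs u v := by
  obtain ⟨t, ht, hv, hl⟩ := h
  exact ⟨t, ht, hv, by omega⟩

theorem bruhatLE.trans {u v w : W} (h : bruhatLE cs u v) (h' : bruhatLE cs v w) :
    bruhatLE cs u w :=
  Relation.ReflTransGen.trans h h'

theorem bruhatLE.eq_or_length_lt {u v : W} (h : bruhatLE cs u v) :
    u = v ∨ cs.length u < cs.length v := by
  induction h with
  | refl => exact Or.inl rfl
  | tail _ hs ih =>
    obtain ⟨t, -, -, hlt⟩ := hs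
    rcases ih with rfl | ih
    · exact Or.inr hlt
    · exact Or.inr (ih.trans hlt)

theorem lengthCov_mul_simple {u : W} {i : B} (h : ¬ cs.IsRightDescent u i) :
    lengthCov cs u (u * cs.simple i) :=
  ⟨_, cs.isReflection_simple i, rfl, cs.not_isRightDescent_iff.1 h⟩

theorem lengthCov_of_isRightDescent {u : W} {i : B} (h : cs.IsRightDescent u i) :
    lengthCov cs (u * cs.simple i) u :=
  ⟨_, cs.isReflection_simple i, by simp, (cs.isRightDescent_iff.1 h).symm⟩

theorem lengthCov_of_isLeftDescent {u : W} {i : B} (h : cs.IsLeftDescent u i) :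
    lengthCov cs (cs.simple i * u) u :=
  ⟨u⁻¹ * cs.simple i * u, by simpa using (cs.isReflection_simple i).conj u⁻¹,
    by simp [mul_assoc], (cs.isLeftDescent_iff.1 h).symm⟩

theorem bruhatStep.mul_simple {u v : W} (h : bruhatStep cs u v) {i : B}
    (hv : v ≠ u * cs.simple i) : bruhatStep cs (u * cs.simple i) (v * cs.simple i) := by
  obtain ⟨t, ht, rfl, hlt⟩ := h
  have hti : t ≠ cs.simple i := fun h => hv (by rw [h])
  refine ⟨cs.simple i * t * (cs.simple i)⁻¹, ht.conj _, by simp [mul_assoc], ?_⟩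
  have h := (ht.length_mul_simple_conj_lt_iff (w := u * t) hti).2
  rw [mul_assoc u t t, ht.mul_self, mul_one] at h
  exact h hlt

theorem bruhatLE.mul_simple_le {u v : W} (h : bruhatLE cs u v) {i : B}
    (hu : ¬ cs.IsRightDescent u i) :
    (¬ cs.IsRightDescent v i → bruhatLE cs (u * cs.simple i) (v * cs.simple i)) ∧
      (cs.IsRightDescent v i → bruhatLE cs (u * cs.simple i) v) := by
  induction h with
  | refl => exact ⟨fun _ => Relation.ReflTransGen.refl, fun h => (hu h).elim⟩
  | @tail z v _ hs ih =>
    have hs : bruhatStep cs z v := hs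
    by_cases hz : cs.IsRightDescent z i
    · have hzv := (ih.2 hz).trans hs.le
      exact ⟨fun hv => hzv.trans (lengthCov_mul_simple hv).bruhatStep.le, fun _ => hzv⟩
    · by_cases hvz : v = z * cs.simple i
      · subst hvz
        refine ⟨fun hv => (hv ?_).elim, fun _ => ih.1 hz⟩
        exact cs.isRightDescent_iff_not_isRightDescent_mul.2 (by simpa using hz)
      · have hzv := (ih.1 hz).trans (hs.mul_simple hvz).le
        exact ⟨fun _ => hzv, fun hv =>
          hzv.trans (lengthCov_of_isRightDescent hv).bruhatStep.le⟩

theorem bruhatStep.exists_lengthCov {u v : W} (h : bruhatStep cs u v) :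
    ∃ z, bruhatLE cs u z ∧ lengthCov cs z v := by
  induction hn : cs.length v using Nat.strong_induction_on generalizing u v with
  | _ n ih =>
  subst hn
  have hlt : cs.length u < cs.length v := h.choose_spec.2.2
  obtain ⟨i, hi⟩ := cs.exists_rightDescent_of_ne_one (w := v) <| by
    rintro rfl
    simp at hlt
  by_cases hvu : v = u * cs.simple i
  · subst hvu
    refine ⟨u, Relation.ReflTransGen.refl, lengthCov_mul_simple ?_⟩
    simp only [CoxeterSystem.IsRightDescent]
    omega
  have hs := h.mul_simple hvu
  by_cases hu : cs.IsRightDescent u i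
  · obtain ⟨z, huz, t, ht, hzv, hl⟩ := ih _ hi hs rfl
    have hui := cs.isRightDescent_iff_not_isRightDescent_mul.1 hu
    have hlift := huz.mul_simple_le hui
    rw [mul_assoc, cs.simple_mul_simple_self, mul_one] at hlift
    by_cases hz : cs.IsRightDescent z i
    · exact ⟨v * cs.simple i, (hlift.2 hz).trans (bruhatStep.le ⟨t, ht, hzv, by omega⟩),
        lengthCov_of_isRightDescent hi⟩
    · refine ⟨z * cs.simple i, hlift.1 hz, cs.simple i * t * (cs.simple i)⁻¹, ht.conj _, ?_, ?_⟩
      · rw [← cs.simple_mul_simple_cancel_right (w := v) i, hzv]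
        simp [mul_assoc]
      · rw [cs.not_isRightDescent_iff.1 hz, ← cs.isRightDescent_iff.1 hi, hl]
  · exact ⟨v * cs.simple i, (lengthCov_mul_simple hu).bruhatStep.le.trans hs.le,
      lengthCov_of_isRightDescent hi⟩

theorem bCov_iff_lengthCov {u v : W} : bCov cs u v ↔ lengthCov cs u v := by
  constructor
  · rintro ⟨hle, hne, hmax⟩
    obtain rfl | ⟨z, huz, hzv⟩ := Relation.ReflTransGen.cases_tail hle
    · exact (hne rfl).elim
    obtain ⟨z', hzz', hzv'⟩ := bruhatStep.exists_lengthCov hzv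
    have hlt : cs.length z' < cs.length v := hzv'.bruhatStep.choose_spec.2.2
    rcases hmax z' (bruhatLE.trans huz hzz') hzv'.bruhatStep.le with rfl | rfl
    · exact hzv'
    · exact (lt_irrefl _ hlt).elim
  · intro h
    have hl : cs.length v = cs.length u + 1 := h.choose_spec.2.2
    refine ⟨h.bruhatStep.le, by rintro rfl; omega, fun z huz hzv => ?_⟩
    rcases huz.eq_or_length_lt with rfl | h₁
    · exact Or.inl rfl
    rcases hzv.eq_or_length_lt with rfl | h₂
    · exact Or.inr rfl
    · omega

theorem lengthCov_mul_simple_iff {v u : W} {i : B} (hv : ¬ cs.IsRightDescent v i) :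
    lengthCov cs u (v * cs.simple i) ↔
      u = v ∨ cs.IsRightDescent u i ∧ lengthCov cs (u * cs.simple i) v := by
  constructor
  · intro h
    by_cases huv : u = v
    · exact Or.inl huv
    right
    have hs := h.bruhatStep.mul_simple (i := i) fun h => huv (mul_right_cancel h).symm
    rw [mul_assoc, cs.simple_mul_simple_self, mul_one] at hs
    obtain ⟨t, ht, hvt, hlt⟩ := hs
    have h₁ : cs.length (v * cs.simple i) = cs.length u + 1 := h.choose_spec.2.2
    have h₂ := cs.not_isRightDescent_iff.1 hv
    have hu : cs.IsRightDescent u i := by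
      simp only [CoxeterSystem.IsRightDescent]
      omega
    have h₃ := cs.isRightDescent_iff.1 hu
    exact ⟨hu, t, ht, hvt, by omega⟩
  · rintro (rfl | ⟨hu, t, ht, rfl, hl⟩)
    · exact lengthCov_mul_simple hv
    · refine ⟨cs.simple i * t * (cs.simple i)⁻¹, ht.conj _, by simp [mul_assoc], ?_⟩
      rw [cs.not_isRightDescent_iff.1 hv, hl, cs.isRightDescent_iff.1 hu]

end BruhatCovers

section DihedralCosets

variable {B : Type*} {W : Type*} [Group W] {M : CoxeterMatrix B} {cs : CoxeterSystem M W}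

theorem CoxeterSystem.exists_isReduced_subset (cs : CoxeterSystem M W) (ω : List B) :
    ∃ ω', ω' ⊆ ω ∧ cs.IsReduced ω' ∧ cs.wordProd ω' = cs.wordProd ω := by
  induction ω using List.reverseRecOn with
  | nil => exact ⟨[], by simp, by simp [CoxeterSystem.IsReduced], rfl⟩
  | append_singleton ω k ih =>
    obtain ⟨ω', hsub, hred, hprod⟩ := ih
    have hprod' : cs.wordProd (ω ++ [k]) = cs.wordProd ω' * cs.simple k := by
      rw [cs.wordProd_append, cs.wordProd_singleton, hprod]
    by_cases hk : cs.IsRightDescent (cs.wordProd ω') k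
    · obtain ⟨j, hj, he⟩ := cs.exists_eraseIdx_of_isRightInversion
        ((cs.isRightInversion_simple_iff_isRightDescent _ _).2 hk)
      refine ⟨ω'.eraseIdx j, fun a ha => List.mem_append_left _
        (hsub (List.mem_of_mem_eraseIdx ha)), ?_, by rw [hprod', he]⟩
      have h₁ := List.length_eraseIdx_add_one hj
      have h₂ := cs.isRightDescent_iff.1 hk
      have h₃ := hred.eq
      rw [CoxeterSystem.IsReduced, ← he]
      omega
    · refine ⟨ω' ++ [k], ?_, ?_, ?_⟩
      · intro a ha
        exact List.mem_append.2 ((List.mem_append.1 ha).imp_left fun h => hsub h)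
      · rw [CoxeterSystem.IsReduced, cs.wordProd_append, cs.wordProd_singleton,
          cs.not_isRightDescent_iff.1 hk, hred.eq]
        simp
      · rw [hprod', cs.wordProd_append, cs.wordProd_singleton]

theorem simple_mem_dihedral {i j k : B} (hk : k = i ∨ k = j) : cs.simple k ∈ dihedral cs i j := by
  apply Subgroup.subset_closure
  rcases hk with rfl | rfl <;> simp

theorem wordProd_mem_dihedral {i j : B} {ω : List B} (hω : ∀ k ∈ ω, k = i ∨ k = j) :
    cs.wordProd ω ∈ dihedral cs i j := by
  refine Subgroup.list_prod_mem _ fun w hw => ?_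
  obtain ⟨k, hk, rfl⟩ := List.mem_map.1 hw
  exact simple_mem_dihedral (hω k hk)

theorem exists_isReduced_of_mem_dihedral {i j : B} {b : W} (hb : b ∈ dihedral cs i j) :
    ∃ ω, (∀ k ∈ ω, k = i ∨ k = j) ∧ cs.IsReduced ω ∧ cs.wordProd ω = b := by
  suffices h : ∃ ω, (∀ k ∈ ω, k = i ∨ k = j) ∧ cs.wordProd ω = b by
    obtain ⟨ω, hω, rfl⟩ := h
    obtain ⟨ω', hsub, hred, hprod⟩ := cs.exists_isReduced_subset ω
    exact ⟨ω', fun k hk => hω k (hsub hk), hred, hprod⟩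
  induction hb using Subgroup.closure_induction with
  | mem x hx =>
    rcases hx with rfl | rfl
    · exact ⟨[i], by simp, by simp⟩
    · exact ⟨[j], by simp, by simp⟩
  | one => exact ⟨[], by simp, by simp⟩
  | mul x y _ _ hx hy =>
    obtain ⟨ω, hω, rfl⟩ := hx
    obtain ⟨ω', hω', rfl⟩ := hy
    refine ⟨ω ++ ω', fun k hk => ?_, cs.wordProd_append _ _⟩
    exact (List.mem_append.1 hk).elim (hω k) (hω' k)
  | inv x _ hx =>
    obtain ⟨ω, hω, rfl⟩ := hx
    exact ⟨ω.reverse, fun k hk => hω k (List.mem_reverse.1 hk), cs.wordProd_reverse ω⟩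

theorem lengthCov.mem_dihedral {i j : B} {u b : W} (h : lengthCov cs u b)
    (hb : b ∈ dihedral cs i j) : u ∈ dihedral cs i j := by
  obtain ⟨ω, hω, -, rfl⟩ := exists_isReduced_of_mem_dihedral hb
  obtain ⟨t, ht, hu, hl⟩ := h
  have hu' : u = cs.wordProd ω * t := by rw [hu, mul_assoc, ht.mul_self, mul_one]
  have hinv : cs.IsRightInversion (cs.wordProd ω) t := ⟨ht, by rw [← hu']; omega⟩
  obtain ⟨n, -, hn⟩ := cs.exists_eraseIdx_of_isRightInversion hinv
  rw [hu', hn]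
  exact wordProd_mem_dihedral fun k hk => hω k (List.mem_of_mem_eraseIdx hk)

theorem eq_of_isReduced_of_head?_eq {i j : B} {ω ω' : List B} (hω : ∀ k ∈ ω, k = i ∨ k = j)
    (hω' : ∀ k ∈ ω', k = i ∨ k = j) (hred : cs.IsReduced ω) (hred' : cs.IsReduced ω')
    (hlen : ω.length = ω'.length) (hhead : ω.head? = ω'.head?) : ω = ω' := by
  have hne : ∀ (k : B) (l : List B), ¬ cs.IsReduced (k :: k :: l) := by
    intro k l h
    have h₁ := cs.length_wordProd_le l
    rw [CoxeterSystem.IsReduced, cs.wordProd_cons, cs.wordProd_cons,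
      cs.simple_mul_simple_cancel_left] at h
    simp only [List.length_cons] at h
    omega
  induction ω generalizing ω' with
  | nil => simpa [eq_comm] using hlen
  | cons k l ih =>
    obtain _ | ⟨k', l'⟩ := ω'
    · simp at hlen
    obtain rfl : k = k' := by simpa using hhead
    congr 1
    refine ih (fun a ha => hω a (by simp [ha])) (fun a ha => hω' a (by simp [ha]))
      (hred.drop 1) (hred'.drop 1) (by simpa using hlen) ?_
    obtain _ | ⟨a, l⟩ := l <;> obtain _ | ⟨a', l'⟩ := l'
    · rfl
    · simp at hlen
    · simp at hlen
    · have h₁ := hω k (by simp)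
      have h₂ := hω a (by simp)
      have h₃ := hω' a' (by simp)
      have h₄ : k ≠ a := by rintro rfl; exact hne _ _ hred
      have h₅ : k ≠ a' := by rintro rfl; exact hne _ _ hred'
      simp only [List.head?_cons, Option.some.injEq]
      grind

/-- A rank-two standard parabolic subgroup has at most two elements of each length. -/
theorem eq_or_eq_or_eq_of_mem_dihedral {i j : B} {u v w : W} (hu : u ∈ dihedral cs i j)
    (hv : v ∈ dihedral cs i j) (hw : w ∈ dihedral cs i j) (huv : cs.length u = cs.length v)
    (huw : cs.length u = cs.length w) : u = v ∨ u = w ∨ v = w := by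
  obtain ⟨α, hα, rα, rfl⟩ := exists_isReduced_of_mem_dihedral hu
  obtain ⟨β, hβ, rβ, rfl⟩ := exists_isReduced_of_mem_dihedral hv
  obtain ⟨γ, hγ, rγ, rfl⟩ := exists_isReduced_of_mem_dihedral hw
  rw [rα.eq, rβ.eq] at huv
  rw [rα.eq, rγ.eq] at huw
  have h₁ := fun h => congrArg cs.wordProd (eq_of_isReduced_of_head?_eq hα hβ rα rβ huv h)
  have h₂ := fun h => congrArg cs.wordProd (eq_of_isReduced_of_head?_eq hα hγ rα rγ huw h)
  have h₃ := fun h => congrArg cs.wordProd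
    (eq_of_isReduced_of_head?_eq hβ hγ rβ rγ (huv.symm.trans huw) h)
  obtain _ | ⟨a, α⟩ := α <;> obtain _ | ⟨b, β⟩ := β <;> obtain _ | ⟨c, γ⟩ := γ <;>
    simp only [List.length_nil, List.length_cons] at huv huw
  · exact Or.inl rfl
  all_goals try omega
  have ha := hα a (by simp)
  have hb := hβ b (by simp)
  have hc := hγ c (by simp)
  simp only [List.head?_cons, Option.some.injEq] at h₁ h₂ h₃
  grind

variable (cs) in
/-- `a` has minimal length in its left coset of `⟨i, j⟩`. -/
def IsMinInDihedralCoset (i j : B) (a : W) : Prop :=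
  ∀ p ∈ dihedral cs i j, cs.length a ≤ cs.length (a * p)

theorem exists_eq_mul_isMinInDihedralCoset (i j : B) (w : W) :
    ∃ a b, w = a * b ∧ b ∈ dihedral cs i j ∧ IsMinInDihedralCoset cs i j a := by
  obtain ⟨p, hp, hmin⟩ := (measure fun p => cs.length (w * p)).wf.has_min (dihedral cs i j)
    ⟨1, Subgroup.one_mem _⟩
  refine ⟨w * p, p⁻¹, by simp, Subgroup.inv_mem _ hp, fun q hq => ?_⟩
  rw [mul_assoc]
  exact not_lt.1 (hmin (p * q) (Subgroup.mul_mem _ hp hq))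

theorem IsMinInDihedralCoset.length_mul {i j : B} {a b : W} (ha : IsMinInDihedralCoset cs i j a)
    (hb : b ∈ dihedral cs i j) : cs.length (a * b) = cs.length a + cs.length b := by
  obtain ⟨ω, hω, hred, rfl⟩ := exists_isReduced_of_mem_dihedral hb
  clear hb
  induction ω using List.reverseRecOn with
  | nil => simp
  | append_singleton ω k ih =>
    have hω' : ∀ l ∈ ω, l = i ∨ l = j := fun l hl => hω l (by simp [hl])
    have hredω : cs.IsReduced ω := by simpa using hred.take ω.length
    have hk : cs.simple k ∈ dihedral cs i j := simple_mem_dihedral (hω k (by simp))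
    have hp := wordProd_mem_dihedral (cs := cs) hω'
    specialize ih hω' hredω
    have hlen := hred.eq
    rw [cs.wordProd_append, cs.wordProd_singleton] at hlen ⊢
    rw [List.length_append, List.length_singleton, ← hredω.eq] at hlen
    rw [hlen, ← mul_assoc, ← add_assoc, ← ih, ← cs.not_isRightDescent_iff]
    intro hdesc
    have h := (cs.isReflection_simple k).inversionParity_ne_zero_iff.2 hdesc
    have h₀ : cs.inversionParity (cs.wordProd ω) (cs.simple k) = 0 := by
      by_contra h₁
      have := (cs.isReflection_simple k).inversionParity_ne_zero_iff.1 h₁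
      omega
    rw [cs.inversionParity_mul, h₀, add_zero] at h
    have h₂ := (cs.isRightInversion_of_inversionParity_ne_zero h).2
    have h₃ := ha _ (Subgroup.mul_mem _ (Subgroup.mul_mem _ hp hk) (Subgroup.inv_mem _ hp))
    omega

theorem IsMinInDihedralCoset.simple_mul {i j k : B} {a : W} (ha : IsMinInDihedralCoset cs i j a)
    (hk : cs.IsLeftDescent a k) : IsMinInDihedralCoset cs i j (cs.simple k * a) := by
  intro p hp
  have h₁ := ha p hp
  have h₂ := cs.isLeftDescent_iff.1 hk
  rcases cs.length_simple_mul (a * p) k with h | h <;> rw [← mul_assoc] at h <;> omega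

theorem IsMinInDihedralCoset.isRightDescent_mul_iff {i j k : B} {a b : W}
    (ha : IsMinInDihedralCoset cs i j a) (hb : b ∈ dihedral cs i j) (hk : k = i ∨ k = j) :
    cs.IsRightDescent (a * b) k ↔ cs.IsRightDescent b k := by
  rw [CoxeterSystem.IsRightDescent, CoxeterSystem.IsRightDescent, mul_assoc,
    ha.length_mul hb, ha.length_mul (Subgroup.mul_mem _ hb (simple_mem_dihedral hk))]
  omega

end DihedralCosets

section Coatoms

variable {B : Type*} {W : Type*} [Group W] {M : CoxeterMatrix B} {cs : CoxeterSystem M W}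

theorem eq_of_common_rightDescent {x y : W} (hxy : ∀ u, lengthCov cs u x ↔ lengthCov cs u y)
    {i : B} (hx : cs.IsRightDescent x i) (hy : cs.IsRightDescent y i) : x = y := by
  have hxi := cs.isRightDescent_iff_not_isRightDescent_mul.1 hx
  have hyi := cs.isRightDescent_iff_not_isRightDescent_mul.1 hy
  have h := (hxy _).1 (lengthCov_of_isRightDescent hx)
  rw [← cs.simple_mul_simple_cancel_right (w := y) i, lengthCov_mul_simple_iff hyi] at h
  rcases h with h | h
  · exact mul_right_cancel h
  · exact (hxi h.1).elim

theorem lengthCov_mul_simple_iff_eq_or_eq {x y : W}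
    (hxy : ∀ u, lengthCov cs u x ↔ lengthCov cs u y) {i : B} (hx : cs.IsRightDescent x i)
    (hy : ¬ cs.IsRightDescent y i) {u : W} (hu : lengthCov cs u (y * cs.simple i)) :
    u = y ∨ u = x := by
  refine ((lengthCov_mul_simple_iff hy).1 hu).imp_right fun ⟨hui, h⟩ => ?_
  have hxi := cs.isRightDescent_iff_not_isRightDescent_mul.1 hx
  rw [← hxy, ← cs.simple_mul_simple_cancel_right (w := x) i, lengthCov_mul_simple_iff hxi] at h
  rcases h with h | h
  · exact mul_right_cancel h
  · exact (cs.isRightDescent_iff_not_isRightDescent_mul.1 hui h.1).elim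

theorem exists_leftDescent_eq_mul {x y : W} (hxy : ∀ u, lengthCov cs u x ↔ lengthCov cs u y)
    {i j k : B} (hk : k = i ∨ k = j) (hx : cs.IsRightDescent x k) (hy : ¬ cs.IsRightDescent y k)
    {a b : W} (hyab : y = a * b) (hb : b ∈ dihedral cs i j) (ha : IsMinInDihedralCoset cs i j a)
    (ha₁ : a ≠ 1) :
    ∃ l, cs.IsLeftDescent a l ∧ x = cs.simple l * a * (b * cs.simple k) := by
  obtain ⟨l, hl⟩ := cs.exists_leftDescent_of_ne_one ha₁
  have hbk : b * cs.simple k ∈ dihedral cs i j := Subgroup.mul_mem _ hb (simple_mem_dihedral hk)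
  have hla := ha.simple_mul hl
  have hdesc : cs.IsRightDescent (cs.simple l * a * (b * cs.simple k)) k := by
    rw [hla.isRightDescent_mul_iff hbk hk, cs.isRightDescent_iff_not_isRightDescent_mul,
      cs.simple_mul_simple_cancel_right, ← ha.isRightDescent_mul_iff hb hk, ← hyab]
    exact hy
  have hcov : lengthCov cs (cs.simple l * a * (b * cs.simple k)) (y * cs.simple k) := by
    have h := lengthCov_of_isLeftDescent (cs := cs) (u := y * cs.simple k) (i := l) <| by
      rw [CoxeterSystem.IsLeftDescent, hyab, mul_assoc a, ← mul_assoc (cs.simple l),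
        hla.length_mul hbk, ha.length_mul hbk]
      exact Nat.add_lt_add_right hl _
    simpa only [hyab, mul_assoc] using h
  rcases lengthCov_mul_simple_iff_eq_or_eq hxy hx hy hcov with h | h
  · exact (hy (h ▸ hdesc)).elim
  · exact ⟨l, hl, h.symm⟩

theorem not_mem_dihedral_of_three_coatoms {x u v w : W} (hu : lengthCov cs u x)
    (hv : lengthCov cs v x) (hw : lengthCov cs w x) (huv : u ≠ v) (huw : u ≠ w) (hvw : v ≠ w)
    (i j : B) : x ∉ dihedral cs i j := by
  intro hx
  have h₁ : cs.length x = cs.length u + 1 := hu.choose_spec.2.2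
  have h₂ : cs.length x = cs.length v + 1 := hv.choose_spec.2.2
  have h₃ : cs.length x = cs.length w + 1 := hw.choose_spec.2.2
  have h := eq_or_eq_or_eq_of_mem_dihedral (hu.mem_dihedral hx) (hv.mem_dihedral hx)
    (hw.mem_dihedral hx) (by omega) (by omega)
  tauto

theorem eq_of_lengthCov_iff {x y : W} (hxy : ∀ u, lengthCov cs u x ↔ lengthCov cs u y)
    (hx₁ : x ≠ 1) (hx : ∀ i j, x ∉ dihedral cs i j) (hy : ∀ i j, y ∉ dihedral cs i j) :
    x = y := by
  by_contra hne
  obtain ⟨i, hi⟩ := cs.exists_rightDescent_of_ne_one hx₁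
  obtain ⟨j, hj⟩ := cs.exists_rightDescent_of_ne_one (w := y) <| by
    rintro rfl
    exact hy i i (Subgroup.one_mem _)
  have hiy : ¬ cs.IsRightDescent y i := fun h => hne (eq_of_common_rightDescent hxy hi h)
  have hjx : ¬ cs.IsRightDescent x j := fun h => hne (eq_of_common_rightDescent hxy h hj)
  obtain ⟨a, b, hyab, hb, ha⟩ := exists_eq_mul_isMinInDihedralCoset (cs := cs) i j y
  have ha₁ : a ≠ 1 := by
    rintro rfl
    exact hy i j (by rwa [hyab, one_mul])
  obtain ⟨k, hk, hxab⟩ := exists_leftDescent_eq_mul hxy (Or.inl rfl) hi hiy hyab hb ha ha₁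
  have hbi : b * cs.simple i ∈ dihedral cs i j :=
    Subgroup.mul_mem _ hb (simple_mem_dihedral (Or.inl rfl))
  have hka₁ : cs.simple k * a ≠ 1 := by
    intro h
    exact hx i j (by rwa [hxab, h, one_mul])
  have hka := ha.simple_mul hk
  obtain ⟨l, hl, hyab'⟩ := exists_leftDescent_eq_mul (fun u => (hxy u).symm) (Or.inr rfl) hj hjx
    hxab hbi hka hka₁
  have hbij : b * cs.simple i * cs.simple j ∈ dihedral cs i j :=
    Subgroup.mul_mem _ hbi (simple_mem_dihedral (Or.inr rfl))
  have hcoset : a * (b * (b * cs.simple i * cs.simple j)⁻¹) =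
      cs.simple l * (cs.simple k * a) := by
    rw [← mul_assoc, ← hyab, hyab', mul_inv_cancel_right]
  have h := ha _ (Subgroup.mul_mem _ hb (Subgroup.inv_mem _ hbij))
  rw [hcoset] at h
  exact (hl.trans hk).not_ge h

end Coatoms

/-- two elements of a Coxeter group with the same set of coatoms in the
Bruhat order, of cardinality at least `3`, are equal. -/
theorem stmt3 {B : Type*} {W : Type*} [Group W] {M : CoxeterMatrix B}
    (cs : CoxeterSystem M W) (x y : W)
    (hcoat : bCoat cs x = bCoat cs y)
    (hcard : ∃ u v w : W, u ∈ bCoat cs x ∧ v ∈ bCoat cs x ∧ w ∈ bCoat cs x ∧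
      u ≠ v ∧ u ≠ w ∧ v ≠ w) :
    x = y := by
  have hxy : ∀ u, lengthCov cs u x ↔ lengthCov cs u y := fun u => by
    rw [← bCov_iff_lengthCov, ← bCov_iff_lengthCov]
    exact Set.ext_iff.1 hcoat u
  obtain ⟨u, v, w, hu, hv, hw, huv, huw, hvw⟩ := hcard
  replace hu : lengthCov cs u x := bCov_iff_lengthCov.1 hu
  replace hv : lengthCov cs v x := bCov_iff_lengthCov.1 hv
  replace hw : lengthCov cs w x := bCov_iff_lengthCov.1 hw
  have hx := not_mem_dihedral_of_three_coatoms hu hv hw huv huw hvw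
  have hy := not_mem_dihedral_of_three_coatoms ((hxy u).1 hu) ((hxy v).1 hv) ((hxy w).1 hw)
    huv huw hvw
  refine eq_of_lengthCov_iff hxy ?_ hx hy
  rintro rfl
  obtain ⟨t, -, -, hl⟩ := hu
  simp at hl
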